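/- Let ℓ ∈ ℝ^{N×N} be a fixed (deterministic) matrix with nonnegative entries and zero diagonal, and let b > 0. For measurable A : Ω → ℝ^N with A(ω) ∈ ℝ^N_{++} for all ω, define ρ(A) = inf{ Σ_i Y_i : Y ∈ 𝒞 with η(Λ(A+Y, ℓ)) ≤ b }. Then ρ is monotone: A₁ ≤ A₂ componentwise ℙ-a.s. implies ρ(A₂) ≤ ρ(A₁); and ρ is convex on its finiteness set: whenever ρ(A₁) < ∞, ρ(A₂) < ∞ and λ ∈ [0,1], one has ρ(λA₁ + (1−λ)A₂) ≤ λρ(A₁) + (1−λ)ρ(A₂). -/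

import Mathlib

open MeasureTheory

/-- Total liability vector: `ℓ̄_i = ∑_j ℓ_{ij}`. -/
noncomputable def lbar {N : ℕ} (ℓ : Fin N → Fin N → ℝ) : Fin N → ℝ := fun i => ∑ j, ℓ i j

/-- Relative liability matrix: `π_{ij} = ℓ_{ij}/ℓ̄_i` if `ℓ̄_i > 0`, else `0`. -/
noncomputable def relPi {N : ℕ} (ℓ : Fin N → Fin N → ℝ) : Fin N → Fin N → ℝ :=
  fun i j => if 0 < lbar ℓ i then ℓ i j / lbar ℓ i else 0

/-- The Eisenberg–Noe clearing map `Φ(p, a, π, ℓ̄) = (πᵀp + a) ∧ ℓ̄`. -/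
noncomputable def Phi {N : ℕ} (π : Fin N → Fin N → ℝ) (a lb p : Fin N → ℝ) : Fin N → ℝ :=
  fun i => min ((∑ j, π j i * p j) + a i) (lb i)

/-- The clearing vector `CV(a, ℓ)`: the (for `a ∈ ℝ^N_{++}` unique) nonnegative fixed
point of the clearing map associated with the liability matrix `ℓ`. -/
noncomputable def clearingVec {N : ℕ} (a : Fin N → ℝ) (ℓ : Fin N → Fin N → ℝ) : Fin N → ℝ :=
  Classical.epsilon fun p => (∀ i, 0 ≤ p i) ∧ Phi (relPi ℓ) a (lbar ℓ) p = p

/-- The Eisenberg–Noe aggregation function `Λ(a, ℓ) = ∑_i (ℓ̄_i − CV_i(a, ℓ))`. -/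
noncomputable def aggLoss {N : ℕ} (a : Fin N → ℝ) (ℓ : Fin N → Fin N → ℝ) : ℝ :=
  ∑ i, (lbar ℓ i - clearingVec a ℓ i)

/-- The feasible total bailout-capital levels: constants `c` such that some admissible
random allocation `Y ∈ 𝒞` with `∑ᵢ Yᵢ = c` a.s. makes the system acceptable. -/
noncomputable def feas {Ω : Type*} [MeasurableSpace Ω] (P : Measure Ω) {N : ℕ}
    (η : (Ω → ℝ) → ℝ) (A : Ω → Fin N → ℝ) (L : Ω → Fin N → Fin N → ℝ) (b : ℝ) : Set ℝ :=
  {c : ℝ | ∃ Y : Ω → Fin N → ℝ, Measurable Y ∧ (∀ ω i, 0 ≤ Y ω i) ∧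
    (∀ᵐ ω ∂P, ∑ i, Y ω i = c) ∧
    η (fun ω => aggLoss (fun i => A ω i + Y ω i) (L ω)) ≤ b}

/-- The systemic risk measure `ρ_b(A, L)`. -/
noncomputable def sysRisk {Ω : Type*} [MeasurableSpace Ω] (P : Measure Ω) {N : ℕ}
    (η : (Ω → ℝ) → ℝ) (A : Ω → Fin N → ℝ) (L : Ω → Fin N → Fin N → ℝ) (b : ℝ) : ℝ :=
  sInf (feas P η A L b)

section ClearingVector

variable {N : ℕ} {ℓ : Fin N → Fin N → ℝ}

lemma lbar_nonneg (hℓ : ∀ i j, 0 ≤ ℓ i j) (i : Fin N) : 0 ≤ lbar ℓ i :=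
  Finset.sum_nonneg fun j _ => hℓ i j

lemma relPi_nonneg (hℓ : ∀ i j, 0 ≤ ℓ i j) (i j : Fin N) : 0 ≤ relPi ℓ i j := by
  unfold relPi
  split_ifs with h
  · exact div_nonneg (hℓ i j) h.le
  · exact le_rfl

lemma sum_relPi_le_one (ℓ : Fin N → Fin N → ℝ) (i : Fin N) : ∑ j, relPi ℓ i j ≤ 1 := by
  unfold relPi
  split_ifs with h
  · rw [← Finset.sum_div]
    exact (div_self h.ne').le
  · simp

lemma Phi_mono {π : Fin N → Fin N → ℝ} (hπ : ∀ i j, 0 ≤ π i j) {a a' lb p p' : Fin N → ℝ}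
    (ha : a ≤ a') (hp : p ≤ p') : Phi π a lb p ≤ Phi π a' lb p' := fun i =>
  min_le_min_right _ (add_le_add
    (Finset.sum_le_sum fun j _ => mul_le_mul_of_nonneg_left (hp j) (hπ j i)) (ha i))

/-- Subsolutions of the clearing equation lie below every nonnegative solution, provided the
endowments are positive and the relative liabilities are substochastic. -/
lemma le_of_le_Phi {π : Fin N → Fin N → ℝ} (hπ : ∀ i j, 0 ≤ π i j) (hπ1 : ∀ i, ∑ j, π i j ≤ 1)
    {a lb p q : Fin N → ℝ} (ha : ∀ i, 0 < a i) (hp : p ≤ Phi π a lb p) (hq0 : 0 ≤ q)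
    (hq : Phi π a lb q = q) : p ≤ q := by
  classical
  let S : Finset (Fin N) := {i | q i < p i}
  have hS : ∀ i, i ∈ S ↔ q i < p i := fun i => by simp [S]
  by_contra hpq
  obtain ⟨i₀, hi₀⟩ : ∃ i, q i < p i := by
    simpa [Pi.le_def] using hpq
  have hne : S.Nonempty := ⟨i₀, (hS i₀).2 hi₀⟩
  have hqS : ∀ i ∈ S, q i = ∑ j, π j i * q j + a i := by
    intro i hi
    have h1 := congrFun hq i
    have h2 := hp i
    have h3 := (hS i).1 hi
    simp only [Phi, le_min_iff] at h1 h2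
    rcases min_choice (∑ j, π j i * q j + a i) (lb i) with h | h <;> linarith [h2.2]
  let w : Fin N → ℝ := fun j => ∑ i ∈ S, π j i
  have hw0 : ∀ j, 0 ≤ w j := fun j => Finset.sum_nonneg fun i _ => hπ j i
  have hw1 : ∀ j, w j ≤ 1 := fun j =>
    (Finset.sum_le_univ_sum_of_nonneg (hπ j)).trans (hπ1 j)
  have swap : ∀ (T : Finset (Fin N)) (f : Fin N → ℝ),
      ∑ i ∈ S, ∑ j ∈ T, π j i * f j = ∑ j ∈ T, w j * f j := by
    intro T f
    rw [Finset.sum_comm]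
    simp only [w, Finset.sum_mul]
  have hd : ∑ i ∈ S, (p i - q i) ≤ ∑ j ∈ S, w j * (p j - q j) := by
    rw [← swap S]
    refine Finset.sum_le_sum fun i hi => ?_
    have h2 := (le_min_iff.1 (hp i)).1
    have h3 : ∑ j, π j i * (p j - q j) ≤ ∑ j ∈ S, π j i * (p j - q j) := by
      rw [← Finset.sum_add_sum_compl S]
      refine add_le_of_nonpos_right (Finset.sum_nonpos fun j hj => ?_)
      exact mul_nonpos_of_nonneg_of_nonpos (hπ j i)
        (sub_nonpos.2 (not_lt.1 fun h => Finset.mem_compl.1 hj ((hS j).2 h)))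
    simp only [mul_sub, Finset.sum_sub_distrib] at h3 ⊢
    linarith [hqS i hi]
  have hwS : ∀ j ∈ S, w j = 1 := by
    have hle : ∀ j ∈ S, w j * (p j - q j) ≤ p j - q j := fun j hj =>
      mul_le_of_le_one_left (sub_nonneg.2 ((hS j).1 hj).le) (hw1 j)
    intro j hj
    have h := (Finset.sum_eq_sum_iff_of_le hle).1 (le_antisymm (Finset.sum_le_sum hle) hd) j hj
    exact mul_right_cancel₀ (sub_pos.2 ((hS j).1 hj)).ne' (h.trans (one_mul _).symm)
  have hsum : ∑ i ∈ S, q i = ∑ j, w j * q j + ∑ i ∈ S, a i := by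
    rw [← swap, ← Finset.sum_add_distrib]
    exact Finset.sum_congr rfl hqS
  have hge : ∑ i ∈ S, q i ≤ ∑ j, w j * q j :=
    calc ∑ i ∈ S, q i = ∑ j ∈ S, w j * q j :=
          Finset.sum_congr rfl fun j hj => by rw [hwS j hj, one_mul]
      _ ≤ _ := Finset.sum_le_univ_sum_of_nonneg fun j => mul_nonneg (hw0 j) (hq0 j)
  linarith [Finset.sum_pos (fun i _ => ha i) hne]

lemma exists_Phi_fixed {π : Fin N → Fin N → ℝ} (hπ : ∀ i j, 0 ≤ π i j) {a lb : Fin N → ℝ}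
    (ha : 0 ≤ a) (hlb : 0 ≤ lb) : ∃ p : Fin N → ℝ, 0 ≤ p ∧ Phi π a lb p = p := by
  let D : Set (Fin N → ℝ) := {p | 0 ≤ p ∧ p ≤ Phi π a lb p}
  have hbdd : BddAbove D := ⟨lb, fun p hp i => (hp.2 i).trans (min_le_right _ _)⟩
  have h0 : (0 : Fin N → ℝ) ∈ D := ⟨le_rfl, fun i => by simpa [Phi] using ⟨ha i, hlb i⟩⟩
  have hs0 : 0 ≤ sSup D := le_csSup hbdd h0
  have hle : sSup D ≤ Phi π a lb (sSup D) :=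
    csSup_le ⟨0, h0⟩ fun p hp => hp.2.trans (Phi_mono hπ le_rfl (le_csSup hbdd hp))
  exact ⟨sSup D, hs0, le_antisymm
    (le_csSup hbdd ⟨hs0.trans hle, Phi_mono hπ le_rfl hle⟩) hle⟩

variable (hℓ : ∀ i j, 0 ≤ ℓ i j)
include hℓ

lemma clearingVec_spec {a : Fin N → ℝ} (ha : ∀ i, 0 < a i) :
    0 ≤ clearingVec a ℓ ∧ Phi (relPi ℓ) a (lbar ℓ) (clearingVec a ℓ) = clearingVec a ℓ :=
  Classical.epsilon_spec
    (p := fun p : Fin N → ℝ => (∀ i, 0 ≤ p i) ∧ Phi (relPi ℓ) a (lbar ℓ) p = p)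
    (exists_Phi_fixed (relPi_nonneg hℓ) (fun i => (ha i).le) (lbar_nonneg hℓ))

lemma clearingVec_le_lbar {a : Fin N → ℝ} (ha : ∀ i, 0 < a i) : clearingVec a ℓ ≤ lbar ℓ :=
  fun i => (congrFun (clearingVec_spec hℓ ha).2 i).ge.trans (min_le_right _ _)

lemma le_clearingVec {a p : Fin N → ℝ} (ha : ∀ i, 0 < a i)
    (hp : p ≤ Phi (relPi ℓ) a (lbar ℓ) p) : p ≤ clearingVec a ℓ :=
  le_of_le_Phi (relPi_nonneg hℓ) (sum_relPi_le_one ℓ) ha hp (clearingVec_spec hℓ ha).1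
    (clearingVec_spec hℓ ha).2

lemma clearingVec_mono {a a' : Fin N → ℝ} (ha : ∀ i, 0 < a i) (h : a ≤ a') :
    clearingVec a ℓ ≤ clearingVec a' ℓ :=
  le_clearingVec hℓ (fun i => (ha i).trans_le (h i)) <|
    (clearingVec_spec hℓ ha).2.ge.trans (Phi_mono (relPi_nonneg hℓ) h le_rfl)

lemma convex_comb_clearingVec_le {a a' : Fin N → ℝ} (ha : ∀ i, 0 < a i) (ha' : ∀ i, 0 < a' i)
    {s t : ℝ} (hs : 0 ≤ s) (ht : 0 ≤ t) (hst : s + t = 1) :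
    s • clearingVec a ℓ + t • clearingVec a' ℓ ≤ clearingVec (s • a + t • a') ℓ := by
  refine le_clearingVec hℓ (fun i => convex_Ioi (0 : ℝ) (ha i) (ha' i) hs ht hst) fun i => ?_
  have h := (congrFun (clearingVec_spec hℓ ha).2 i).ge
  have h' := (congrFun (clearingVec_spec hℓ ha').2 i).ge
  simp only [Phi, le_min_iff] at h h' ⊢
  constructor
  · calc s * clearingVec a ℓ i + t * clearingVec a' ℓ i
        ≤ s * (∑ j, relPi ℓ j i * clearingVec a ℓ j + a i)
          + t * (∑ j, relPi ℓ j i * clearingVec a' ℓ j + a' i) :=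
          add_le_add (mul_le_mul_of_nonneg_left h.1 hs) (mul_le_mul_of_nonneg_left h'.1 ht)
      _ = _ := by
          simp only [Pi.add_apply, Pi.smul_apply, smul_eq_mul, mul_add, Finset.sum_add_distrib,
            Finset.mul_sum, mul_left_comm]
          ring
  · exact convex_Iic (lbar ℓ i) h.2 h'.2 hs ht hst

lemma aggLoss_nonneg {a : Fin N → ℝ} (ha : ∀ i, 0 < a i) : 0 ≤ aggLoss a ℓ :=
  Finset.sum_nonneg fun i _ => sub_nonneg.2 (clearingVec_le_lbar hℓ ha i)

lemma aggLoss_le {a : Fin N → ℝ} (ha : ∀ i, 0 < a i) : aggLoss a ℓ ≤ ∑ i, lbar ℓ i :=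
  Finset.sum_le_sum fun i _ => sub_le_self _ ((clearingVec_spec hℓ ha).1 i)

lemma aggLoss_anti {a a' : Fin N → ℝ} (ha : ∀ i, 0 < a i) (h : a ≤ a') :
    aggLoss a' ℓ ≤ aggLoss a ℓ :=
  Finset.sum_le_sum fun i _ => sub_le_sub_left (clearingVec_mono hℓ ha h i) _

lemma aggLoss_eq_zero {a : Fin N → ℝ} (ha : ∀ i, 0 < a i) (h : lbar ℓ ≤ a) :
    aggLoss a ℓ = 0 := by
  have hle : lbar ℓ ≤ clearingVec a ℓ := le_clearingVec hℓ ha fun i =>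
    le_min (le_add_of_nonneg_of_le (Finset.sum_nonneg fun j _ =>
      mul_nonneg (relPi_nonneg hℓ j i) (lbar_nonneg hℓ j)) (h i)) le_rfl
  exact Finset.sum_eq_zero fun i _ => sub_eq_zero.2 (le_antisymm (hle i)
    (clearingVec_le_lbar hℓ ha i))

lemma convexOn_aggLoss : ConvexOn ℝ {a : Fin N → ℝ | ∀ i, 0 < a i} fun a => aggLoss a ℓ := by
  refine ⟨fun a ha a' ha' s t hs ht hst i => convex_Ioi (0 : ℝ) (ha i) (ha' i) hs ht hst,
    fun a ha a' ha' s t hs ht hst => ?_⟩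
  simp only [aggLoss, smul_eq_mul, Finset.mul_sum, ← Finset.sum_add_distrib]
  refine Finset.sum_le_sum fun i _ => ?_
  have h := convex_comb_clearingVec_le hℓ ha ha' hs ht hst i
  simp only [Pi.add_apply, Pi.smul_apply, smul_eq_mul] at h
  have hl : lbar ℓ i = s * lbar ℓ i + t * lbar ℓ i := by rw [← add_mul, hst, one_mul]
  linarith

lemma measurable_aggLoss_comp {Ω : Type*} [MeasurableSpace Ω] {X : Ω → Fin N → ℝ}
    (hX : Measurable X) (hpos : ∀ ω i, 0 < X ω i) : Measurable fun ω => aggLoss (X ω) ℓ := by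
  have hopen : IsOpen {a : Fin N → ℝ | ∀ i, 0 < a i} := by
    simp only [Set.ofPred_forall]
    exact isOpen_iInter_of_finite fun i => isOpen_lt continuous_const (continuous_apply i)
  have hc := continuousOn_iff_continuous_domRestrict.1 ((convexOn_aggLoss hℓ).continuousOn hopen)
  exact hc.measurable.comp (hX.subtype_mk (h := hpos))

lemma integrable_aggLoss_comp {Ω : Type*} [MeasurableSpace Ω] (P : Measure Ω)
    [IsFiniteMeasure P] {X : Ω → Fin N → ℝ} (hX : Measurable X) (hpos : ∀ ω i, 0 < X ω i) :
    Integrable (fun ω => aggLoss (X ω) ℓ) P :=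
  .of_bound (measurable_aggLoss_comp hℓ hX hpos).aestronglyMeasurable (∑ i, lbar ℓ i) <|
    .of_forall fun ω => by
      rw [Real.norm_of_nonneg (aggLoss_nonneg hℓ (hpos ω))]
      exact aggLoss_le hℓ (hpos ω)

end ClearingVector

section Feasibility

variable {Ω : Type*} [MeasurableSpace Ω] {P : Measure Ω} [IsProbabilityMeasure P] {N : ℕ}
  {η : (Ω → ℝ) → ℝ} {b : ℝ}

lemma feas_bddBelow (A : Ω → Fin N → ℝ) (L : Ω → Fin N → Fin N → ℝ) :
    BddBelow (feas P η A L b) := by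
  refine ⟨0, ?_⟩
  rintro c ⟨Y, -, hY0, hYc, -⟩
  obtain ⟨ω, hω⟩ := hYc.exists
  exact hω ▸ Finset.sum_nonneg fun i _ => hY0 ω i

variable {ℓ : Fin N → Fin N → ℝ} (hℓ : ∀ i j, 0 ≤ ℓ i j)
include hℓ

omit [IsProbabilityMeasure P] in
lemma feas_nonempty (hb : 0 ≤ b) (hη_norm : η (fun _ => 0) = 0) {A : Ω → Fin N → ℝ}
    (hA : ∀ ω i, 0 < A ω i) : (feas P η A (fun _ => ℓ) b).Nonempty := by
  refine ⟨∑ i, lbar ℓ i, fun _ => lbar ℓ, measurable_const, fun _ => lbar_nonneg hℓ,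
    .of_forall fun _ => rfl, ?_⟩
  have h : (fun ω => aggLoss (fun i => A ω i + lbar ℓ i) ℓ) = fun _ => 0 := funext fun ω =>
    aggLoss_eq_zero hℓ (fun i => add_pos_of_pos_of_nonneg (hA ω i) (lbar_nonneg hℓ i))
      fun i => le_add_of_nonneg_left (hA ω i).le
  rw [h, hη_norm]
  exact hb

lemma feas_mono
    (hη_mono : ∀ X Y : Ω → ℝ, Integrable X P → Integrable Y P →
      (∀ᵐ ω ∂P, X ω ≤ Y ω) → η X ≤ η Y)
    {A₁ A₂ : Ω → Fin N → ℝ} (hA₁ : Measurable A₁) (hA₂ : Measurable A₂)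
    (hp₁ : ∀ ω i, 0 < A₁ ω i) (hp₂ : ∀ ω i, 0 < A₂ ω i)
    (hle : ∀ᵐ ω ∂P, ∀ i, A₁ ω i ≤ A₂ ω i) :
    feas P η A₁ (fun _ => ℓ) b ⊆ feas P η A₂ (fun _ => ℓ) b := by
  rintro c ⟨Y, hY, hY0, hYc, hYb⟩
  have hpos₁ : ∀ ω i, 0 < A₁ ω i + Y ω i := fun ω i =>
    add_pos_of_pos_of_nonneg (hp₁ ω i) (hY0 ω i)
  have hpos₂ : ∀ ω i, 0 < A₂ ω i + Y ω i := fun ω i =>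
    add_pos_of_pos_of_nonneg (hp₂ ω i) (hY0 ω i)
  refine ⟨Y, hY, hY0, hYc, (hη_mono _ _ (integrable_aggLoss_comp hℓ P (hA₂.add hY) hpos₂)
    (integrable_aggLoss_comp hℓ P (hA₁.add hY) hpos₁) ?_).trans hYb⟩
  filter_upwards [hle] with ω hω
  exact aggLoss_anti hℓ (hpos₁ ω) fun i => add_le_add_left (hω i) _

lemma convex_comb_mem_feas
    (hη_mono : ∀ X Y : Ω → ℝ, Integrable X P → Integrable Y P →
      (∀ᵐ ω ∂P, X ω ≤ Y ω) → η X ≤ η Y)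
    (hη_conv : ∀ X Y : Ω → ℝ, Integrable X P → Integrable Y P → ∀ t : ℝ, 0 ≤ t → t ≤ 1 →
      η (fun ω => t * X ω + (1 - t) * Y ω) ≤ t * η X + (1 - t) * η Y)
    {A₁ A₂ : Ω → Fin N → ℝ} (hA₁ : Measurable A₁) (hA₂ : Measurable A₂)
    (hp₁ : ∀ ω i, 0 < A₁ ω i) (hp₂ : ∀ ω i, 0 < A₂ ω i) {t : ℝ} (ht0 : 0 ≤ t) (ht1 : t ≤ 1)
    {c₁ c₂ : ℝ} (hc₁ : c₁ ∈ feas P η A₁ (fun _ => ℓ) b)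
    (hc₂ : c₂ ∈ feas P η A₂ (fun _ => ℓ) b) :
    t * c₁ + (1 - t) * c₂ ∈
      feas P η (fun ω i => t * A₁ ω i + (1 - t) * A₂ ω i) (fun _ => ℓ) b := by
  obtain ⟨Y₁, hY₁, hY0₁, hYc₁, hYb₁⟩ := hc₁
  obtain ⟨Y₂, hY₂, hY0₂, hYc₂, hYb₂⟩ := hc₂
  have ht' : 0 ≤ 1 - t := sub_nonneg.2 ht1
  have hpos₁ : ∀ ω i, 0 < (A₁ + Y₁) ω i := fun ω i =>
    add_pos_of_pos_of_nonneg (hp₁ ω i) (hY0₁ ω i)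
  have hpos₂ : ∀ ω i, 0 < (A₂ + Y₂) ω i := fun ω i =>
    add_pos_of_pos_of_nonneg (hp₂ ω i) (hY0₂ ω i)
  have hint₁ := integrable_aggLoss_comp hℓ P (hA₁.add hY₁) hpos₁
  have hint₂ := integrable_aggLoss_comp hℓ P (hA₂.add hY₂) hpos₂
  refine ⟨t • Y₁ + (1 - t) • Y₂, (hY₁.const_smul t).add (hY₂.const_smul (1 - t)),
    fun ω i => add_nonneg (mul_nonneg ht0 (hY0₁ ω i)) (mul_nonneg ht' (hY0₂ ω i)), ?_, ?_⟩
  · filter_upwards [hYc₁, hYc₂] with ω h₁ h₂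
    simp [Finset.sum_add_distrib, ← Finset.mul_sum, h₁, h₂]
  · have heq : (fun ω i => t * A₁ ω i + (1 - t) * A₂ ω i + (t • Y₁ + (1 - t) • Y₂) ω i) =
        t • (A₁ + Y₁) + (1 - t) • (A₂ + Y₂) := by
      ext ω i
      simp only [Pi.add_apply, Pi.smul_apply, smul_eq_mul]
      ring
    have hint := integrable_aggLoss_comp hℓ P
      (((hA₁.add hY₁).const_smul t).add ((hA₂.add hY₂).const_smul (1 - t)))
      fun ω i => convex_Ioi (0 : ℝ) (hpos₁ ω i) (hpos₂ ω i) ht0 ht' (add_sub_cancel t 1)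
    have hfun : (fun ω => aggLoss (fun i => t * A₁ ω i + (1 - t) * A₂ ω i
          + (t • Y₁ + (1 - t) • Y₂) ω i) ℓ) =
        fun ω => aggLoss ((t • (A₁ + Y₁) + (1 - t) • (A₂ + Y₂)) ω) ℓ :=
      funext fun ω => congrArg (aggLoss · ℓ) (congrFun heq ω)
    rw [hfun]
    calc η _ ≤ η fun ω => t * aggLoss ((A₁ + Y₁) ω) ℓ + (1 - t) * aggLoss ((A₂ + Y₂) ω) ℓ :=
          hη_mono _ _ hint ((hint₁.const_mul t).add (hint₂.const_mul (1 - t))) <|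
            .of_forall fun ω =>
              (convexOn_aggLoss hℓ).2 (hpos₁ ω) (hpos₂ ω) ht0 ht' (add_sub_cancel t 1)
      _ ≤ _ := hη_conv _ _ hint₁ hint₂ t ht0 ht1
      _ ≤ b := convex_Iic b hYb₁ hYb₂ ht0 ht' (add_sub_cancel t 1)

end Feasibility

/-- For a deterministic liability matrix `ℓ` and `b > 0`, the systemic risk
measure `A ↦ ρ(A) = inf{∑ᵢ Yᵢ : Y ∈ 𝒞, η(Λ(A+Y, ℓ)) ≤ b}` is monotone
(`A₁ ≤ A₂` a.s. implies `ρ(A₂) ≤ ρ(A₁)`) and convex on its finiteness set. -/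
theorem sysRisk_monotone_convex
    {Ω : Type*} [MeasurableSpace Ω] (P : Measure Ω) [IsProbabilityMeasure P]
    (N : ℕ) (hN : 1 ≤ N)
    (ℓ : Fin N → Fin N → ℝ) (hℓ : ∀ i j, 0 ≤ ℓ i j) (hdiag : ∀ i, ℓ i i = 0)
    (b : ℝ) (hb : 0 < b)
    (η : (Ω → ℝ) → ℝ)
    (hη_mono : ∀ X Y : Ω → ℝ, Integrable X P → Integrable Y P →
      (∀ᵐ ω ∂P, X ω ≤ Y ω) → η X ≤ η Y)
    (hη_conv : ∀ X Y : Ω → ℝ, Integrable X P → Integrable Y P → ∀ t : ℝ, 0 ≤ t → t ≤ 1 →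
      η (fun ω => t * X ω + (1 - t) * Y ω) ≤ t * η X + (1 - t) * η Y)
    (hη_norm : η (fun _ => 0) = 0)
    (hη_cont : ∀ ε : ℝ, 0 < ε → ∃ δ : ℝ, 0 < δ ∧ ∀ X Y : Ω → ℝ,
      Integrable X P → Integrable Y P → (∫ ω, |X ω - Y ω| ∂P) < δ → |η X - η Y| < ε) :
    (∀ A₁ A₂ : Ω → Fin N → ℝ, Measurable A₁ → Measurable A₂ →
      (∀ ω i, 0 < A₁ ω i) → (∀ ω i, 0 < A₂ ω i) →
      (∀ᵐ ω ∂P, ∀ i, A₁ ω i ≤ A₂ ω i) →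
      sysRisk P η A₂ (fun _ => ℓ) b ≤ sysRisk P η A₁ (fun _ => ℓ) b) ∧
    (∀ A₁ A₂ : Ω → Fin N → ℝ, Measurable A₁ → Measurable A₂ →
      (∀ ω i, 0 < A₁ ω i) → (∀ ω i, 0 < A₂ ω i) →
      (feas P η A₁ (fun _ => ℓ) b).Nonempty → (feas P η A₂ (fun _ => ℓ) b).Nonempty →
      ∀ t : ℝ, 0 ≤ t → t ≤ 1 →
        sysRisk P η (fun ω i => t * A₁ ω i + (1 - t) * A₂ ω i) (fun _ => ℓ) b ≤
          t * sysRisk P η A₁ (fun _ => ℓ) b + (1 - t) * sysRisk P η A₂ (fun _ => ℓ) b) := by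
  refine ⟨fun A₁ A₂ hA₁ hA₂ hp₁ hp₂ hle => csInf_le_csInf (feas_bddBelow _ _)
    (feas_nonempty hℓ hb.le hη_norm hp₁) (feas_mono hℓ hη_mono hA₁ hA₂ hp₁ hp₂ hle), ?_⟩
  intro A₁ A₂ hA₁ hA₂ hp₁ hp₂ hne₁ hne₂ t ht0 ht1
  refine le_of_forall_pos_le_add fun ε hε => ?_
  obtain ⟨c₁, hc₁, hlt₁⟩ := Real.lt_sInf_add_pos hne₁ hε
  obtain ⟨c₂, hc₂, hlt₂⟩ := Real.lt_sInf_add_pos hne₂ hε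
  refine (csInf_le (feas_bddBelow _ _)
    (convex_comb_mem_feas hℓ hη_mono hη_conv hA₁ hA₂ hp₁ hp₂ ht0 ht1 hc₁ hc₂)).trans ?_
  have h₁ := mul_le_mul_of_nonneg_left hlt₁.le ht0
  have h₂ := mul_le_mul_of_nonneg_left hlt₂.le (sub_nonneg.2 ht1)
  unfold sysRisk
  linarith
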